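/- Let b,p>0. Suppose that for every N∈ℕ (with p/N≤1) there is a probability space carrying i.i.d. random pairs (X_N^{(1)},Y_N^{(1)}),…,(X_N^{(N)},Y_N^{(N)}) of ℕ₀-valued random variables such that X_N^{(1)} is Binomial(⌊bN⌋,p/N)-distributed, Y_N^{(1)} is Poisson(bp)-distributed, and P(X_N^{(1)} ≠ Y_N^{(1)}) → 0 as N→∞. Then for every ε>0, lim_{N→∞} (1/N)·log P( Σ_{j=1}^N |X_N^{(j)} − Y_N^{(j)}| > εN ) = −∞. -/

import Mathlib

open scoped BigOperators

/-- The Poisson probability mass function with parameter `l`. -/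
noncomputable def poissonPMF (l : ℝ) (k : ℕ) : ℝ := Real.exp (-l) * l ^ k / (Nat.factorial k : ℝ)

/-- The binomial probability mass function with parameters `n` and `q`. -/
noncomputable def binPMF (n : ℕ) (q : ℝ) (k : ℕ) : ℝ :=
  (n.choose k : ℝ) * q ^ k * (1 - q) ^ (n - k)

/-- The measure on `ℕ` with mass function `f`. -/
noncomputable def pmfMeasure (f : ℕ → ℝ) : MeasureTheory.Measure ℕ :=
  MeasureTheory.Measure.sum fun k => (ENNReal.ofReal (f k)) • MeasureTheory.Measure.dirac k

/-- Extended-real-valued logarithm: `elog x = log x` for `x > 0` and `⊥` for `x ≤ 0`. -/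
noncomputable def elog (x : ℝ) : EReal := if x ≤ 0 then ⊥ else ((Real.log x : ℝ) : EReal)


open MeasureTheory ProbabilityTheory in
lemma aux_lint (f : ℕ → ℝ) (g : ℕ → ENNReal) :
    ∫⁻ k, g k ∂(pmfMeasure f) = ∑' k, ENNReal.ofReal (f k) * g k := by
  unfold pmfMeasure
  rw [lintegral_sum_measure]
  simp

lemma aux_poisson (l z : ℝ) (hl : 0 ≤ l) (hz : 0 ≤ z) :
    ∑' k, ENNReal.ofReal (poissonPMF l k) * ENNReal.ofReal (z ^ k)
      = ENNReal.ofReal (Real.exp (l * (z - 1))) := by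
  have h0 : ∀ k, 0 ≤ poissonPMF l k := fun k => by unfold poissonPMF; positivity
  have hs : HasSum (fun k => poissonPMF l k * z ^ k) (Real.exp (l * (z - 1))) := by
    have h := (NormedSpace.expSeries_div_hasSum_exp (l * z)).mul_left (Real.exp (-l))
    rw [← Real.exp_eq_exp_ℝ, ← Real.exp_add] at h
    have e1 : (fun k => poissonPMF l k * z ^ k)
        = fun k : ℕ => Real.exp (-l) * ((l * z) ^ k / (k.factorial : ℝ)) := by
      funext k; unfold poissonPMF; rw [mul_pow]; ring
    have e2 : l * (z - 1) = -l + l * z := by ring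
    rw [e1, e2]; exact h
  rw [← hs.tsum_eq, ENNReal.ofReal_tsum_of_nonneg (fun k => mul_nonneg (h0 k) (by positivity)) hs.summable]
  exact tsum_congr fun k => (ENNReal.ofReal_mul (h0 k)).symm

lemma aux_bin (n : ℕ) (q z : ℝ) (hq : 0 ≤ q) (hq1 : q ≤ 1) (hz : 0 ≤ z) :
    ∑' k, ENNReal.ofReal (binPMF n q k) * ENNReal.ofReal (z ^ k)
      ≤ ENNReal.ofReal (Real.exp (n * q * (z - 1))) := by
  have hq2 : 0 ≤ 1 - q := by linarith
  have h0 : ∀ k, 0 ≤ binPMF n q k := fun k => by unfold binPMF; positivity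
  rw [tsum_eq_sum (s := Finset.range (n + 1))]
  · simp_rw [← ENNReal.ofReal_mul (h0 _)]
    rw [← ENNReal.ofReal_sum_of_nonneg (fun k _ => mul_nonneg (h0 k) (by positivity))]
    apply ENNReal.ofReal_le_ofReal
    have : ∑ k ∈ Finset.range (n + 1), binPMF n q k * z ^ k = (q * z + (1 - q)) ^ n := by
      rw [add_pow]
      refine Finset.sum_congr rfl fun k _ => ?_
      unfold binPMF; rw [mul_pow]; ring
    rw [this, mul_assoc, Real.exp_nat_mul]
    refine pow_le_pow_left₀ (by positivity) ?_ n
    have := Real.add_one_le_exp (q * (z - 1))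
    linarith
  · intro k hk
    have : n < k := by simpa using hk
    simp [binPMF, Nat.choose_eq_zero_of_lt this]

lemma aux_pt (θ M : ℝ) (hθ : 0 < θ) (hM : 0 < M) (x y : ℕ) :
    Real.exp (θ * |(x : ℝ) - y|) ≤
      1 + (if x ≠ y then M else 0) + M⁻¹ * (Real.exp (4 * θ) ^ x + Real.exp (4 * θ) ^ y) := by
  by_cases h : x = y
  · subst h; simp; positivity
  rw [if_pos h]
  have h1 : |(x : ℝ) - y| ≤ x + y := by
    rw [abs_le]; constructor <;> linarith [Nat.cast_nonneg (α := ℝ) x, Nat.cast_nonneg (α := ℝ) y]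
  have h2 : Real.exp (θ * |(x : ℝ) - y|) ≤ Real.exp (θ * x) * Real.exp (θ * y) := by
    rw [← Real.exp_add]; apply Real.exp_le_exp.2; nlinarith
  have hx : Real.exp (4 * θ) ^ x = Real.exp (θ * x) ^ 4 := by
    rw [← Real.exp_nat_mul, ← Real.exp_nat_mul]; congr 1; push_cast; ring
  have hy : Real.exp (4 * θ) ^ y = Real.exp (θ * y) ^ 4 := by
    rw [← Real.exp_nat_mul, ← Real.exp_nat_mul]; congr 1; push_cast; ring
  rw [hx, hy]
  set u := Real.exp (θ * x)
  set v := Real.exp (θ * y)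
  have hu : 0 < u := Real.exp_pos _
  have hv : 0 < v := Real.exp_pos _
  refine h2.trans ?_
  have h3 : u * v ≤ M + M⁻¹ * (u * v) ^ 2 := by
    have : M + M⁻¹ * (u * v) ^ 2 - u * v = M⁻¹ * ((u * v - M / 2) ^ 2 + 3 / 4 * M ^ 2) := by
      field_simp; ring
    have : 0 ≤ M⁻¹ * ((u * v - M / 2) ^ 2 + 3 / 4 * M ^ 2) := by positivity
    linarith
  have h4 : M⁻¹ * (u * v) ^ 2 ≤ M⁻¹ * (u ^ 4 + v ^ 4) := by
    apply mul_le_mul_of_nonneg_left _ (by positivity)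
    nlinarith [sq_nonneg (u ^ 2 - v ^ 2), sq_nonneg (u ^ 2 + v ^ 2)]
  linarith

open MeasureTheory ProbabilityTheory in
lemma aux_mom {Ω : Type} [MeasurableSpace Ω] (P : Measure Ω) [IsProbabilityMeasure P]
    (X Y : Ω → ℕ) (hX : Measurable X) (hY : Measurable Y) (θ C : ℝ) (hθ : 0 < θ) (hC : 0 < C)
    (hCX : ∫⁻ k, ENNReal.ofReal (Real.exp (4 * θ) ^ k) ∂(P.map X) ≤ ENNReal.ofReal C)
    (hCY : ∫⁻ k, ENNReal.ofReal (Real.exp (4 * θ) ^ k) ∂(P.map Y) ≤ ENNReal.ofReal C)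
    (hA : P {ω | X ω ≠ Y ω} ≤ ENNReal.ofReal (1 / (8 * C))) :
    ∫⁻ ω, ENNReal.ofReal (Real.exp (θ * |(X ω : ℝ) - Y ω|)) ∂P ≤ ENNReal.ofReal 2 := by
  have hAm : MeasurableSet {ω | X ω ≠ Y ω} := (measurableSet_eq_fun hX hY).compl
  rw [lintegral_map (measurable_of_countable _) hX] at hCX
  rw [lintegral_map (measurable_of_countable _) hY] at hCY
  have hM : 0 < 4 * C := by positivity
  have mX : Measurable fun ω => ENNReal.ofReal (Real.exp (4 * θ) ^ X ω) :=
    (measurable_of_countable fun k : ℕ => ENNReal.ofReal (Real.exp (4 * θ) ^ k)).comp hX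
  have mY : Measurable fun ω => ENNReal.ofReal (Real.exp (4 * θ) ^ Y ω) :=
    (measurable_of_countable fun k : ℕ => ENNReal.ofReal (Real.exp (4 * θ) ^ k)).comp hY
  calc ∫⁻ ω, ENNReal.ofReal (Real.exp (θ * |(X ω : ℝ) - Y ω|)) ∂P
      ≤ ∫⁻ ω, ((1 + {ω | X ω ≠ Y ω}.indicator (fun _ => ENNReal.ofReal (4 * C)) ω)
        + ENNReal.ofReal (4 * C)⁻¹ * (ENNReal.ofReal (Real.exp (4 * θ) ^ X ω)
          + ENNReal.ofReal (Real.exp (4 * θ) ^ Y ω))) ∂P := by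
        refine lintegral_mono fun ω => ?_
        refine (ENNReal.ofReal_le_ofReal (aux_pt θ (4 * C) hθ hM (X ω) (Y ω))).trans ?_
        rw [ENNReal.ofReal_add (by split_ifs <;> positivity) (by positivity),
          ENNReal.ofReal_add (by positivity) (by split_ifs <;> positivity),
          ENNReal.ofReal_mul (by positivity), ENNReal.ofReal_add (by positivity) (by positivity)]
        by_cases h : X ω = Y ω <;> simp [h]
    _ = 1 + ENNReal.ofReal (4 * C) * P {ω | X ω ≠ Y ω}
        + ENNReal.ofReal (4 * C)⁻¹ * (∫⁻ ω, ENNReal.ofReal (Real.exp (4 * θ) ^ X ω) ∂P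
          + ∫⁻ ω, ENNReal.ofReal (Real.exp (4 * θ) ^ Y ω) ∂P) := by
        have mI : Measurable fun ω => 1 + {ω | X ω ≠ Y ω}.indicator (fun _ => ENNReal.ofReal (4 * C)) ω :=
          Measurable.add (f := fun _ => (1 : ENNReal)) measurable_const (measurable_const.indicator hAm)
        have mXY : Measurable fun ω => ENNReal.ofReal (Real.exp (4 * θ) ^ X ω)
          + ENNReal.ofReal (Real.exp (4 * θ) ^ Y ω) := mX.add mY
        rw [lintegral_add_left mI,
          lintegral_add_left measurable_const, lintegral_indicator_const hAm,
          lintegral_const_mul _ mXY, lintegral_add_left mX]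
        simp
    _ ≤ 1 + ENNReal.ofReal (4 * C) * ENNReal.ofReal (1 / (8 * C))
        + ENNReal.ofReal (4 * C)⁻¹ * (ENNReal.ofReal C + ENNReal.ofReal C) := by gcongr
    _ = ENNReal.ofReal 2 := by
        rw [← ENNReal.ofReal_add hC.le hC.le, ← ENNReal.ofReal_mul (by positivity),
          ← ENNReal.ofReal_mul (by positivity), ← ENNReal.ofReal_one,
          ← ENNReal.ofReal_add (by positivity) (by positivity),
          ← ENNReal.ofReal_add (by positivity) (by positivity)]
        congr 1
        field_simp
        norm_num

open MeasureTheory ProbabilityTheory in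
lemma aux_markov {Ω : Type} [MeasurableSpace Ω] (P : Measure Ω)
    (N : ℕ) (W : Fin N → Ω → ENNReal) (mW : ∀ j, Measurable (W j))
    (hi : iIndepFun W P) (K c : ENNReal) (hm : ∀ j, ∫⁻ ω, W j ω ∂P ≤ K) :
    c * P {ω | c ≤ ∏ j : Fin N, W j ω} ≤ K ^ N := by
  have hprod := lintegral_prod_eq_prod_lintegral_of_indepFun Finset.univ W hi mW
  have hle : ∏ j : Fin N, ∫⁻ ω, W j ω ∂P ≤ K ^ N := by
    refine (Finset.prod_le_prod' fun j _ => hm j).trans ?_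
    simp
  rw [← hprod] at hle
  have mP : Measurable fun ω => ∏ j : Fin N, W j ω := Finset.measurable_fun_prod _ fun j _ => mW j
  exact (mul_meas_ge_le_lintegral mP c).trans hle

open MeasureTheory ProbabilityTheory in
lemma aux_chernoff {Ω : Type} [MeasurableSpace Ω] (P : Measure Ω) [IsProbabilityMeasure P]
    (N : ℕ) (X Y : Fin N → Ω → ℕ) (hX : ∀ j, Measurable (X j)) (hY : ∀ j, Measurable (Y j))
    (hi : iIndepFun (fun j ω => (X j ω, Y j ω)) P) (θ ε : ℝ) (hθ : 0 < θ)
    (hm : ∀ j, ∫⁻ ω, ENNReal.ofReal (Real.exp (θ * |(X j ω : ℝ) - Y j ω|)) ∂P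
      ≤ ENNReal.ofReal 2) :
    (P {ω | ε * (N : ℝ) < ∑ j : Fin N, |((X j ω : ℝ)) - ((Y j ω : ℝ))|}).toReal
      ≤ Real.exp (N * (Real.log 2 - θ * ε)) := by
  obtain ⟨g, hg⟩ : ∃ g : ℕ × ℕ → ENNReal, ∀ x y : ℕ,
      ENNReal.ofReal (Real.exp (θ * |(x : ℝ) - y|)) = g (x, y) :=
    ⟨fun a => ENNReal.ofReal (Real.exp (θ * |(a.1 : ℝ) - a.2|)), fun x y => rfl⟩
  have mg : Measurable g := measurable_of_countable _
  simp only [hg] at hm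
  have mW : ∀ j, Measurable fun ω => g (X j ω, Y j ω) :=
    fun j => mg.comp ((hX j).prodMk (hY j))
  have hiW : iIndepFun (fun j ω => g (X j ω, Y j ω)) P := hi.comp (fun _ => g) (fun _ => mg)
  have hmk := aux_markov P N _ mW hiW (ENNReal.ofReal 2)
    (ENNReal.ofReal (Real.exp (θ * (ε * N)))) hm
  have hsub : P {ω | ε * (N : ℝ) < ∑ j : Fin N, |((X j ω : ℝ)) - ((Y j ω : ℝ))|} ≤
      P {ω | ENNReal.ofReal (Real.exp (θ * (ε * N))) ≤
        ∏ j : Fin N, g (X j ω, Y j ω)} := by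
    refine measure_mono fun ω hω => ?_
    simp only [Set.mem_setOf_eq, ← hg] at hω ⊢
    rw [← ENNReal.ofReal_prod_of_nonneg (fun _ _ => (Real.exp_pos _).le), ← Real.exp_sum,
      ← Finset.mul_sum]
    exact ENNReal.ofReal_le_ofReal (Real.exp_le_exp.2 (mul_le_mul_of_nonneg_left hω.le hθ.le))
  have hfin : ENNReal.ofReal (Real.exp (θ * (ε * N))) *
      P {ω | ε * (N : ℝ) < ∑ j : Fin N, |((X j ω : ℝ)) - ((Y j ω : ℝ))|} ≤
      ENNReal.ofReal (2 ^ N) := by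
    rw [ENNReal.ofReal_pow (by norm_num)]
    exact le_trans (mul_le_mul_right hsub _) hmk
  have h2 := ENNReal.toReal_mono ENNReal.ofReal_ne_top hfin
  rw [ENNReal.toReal_mul, ENNReal.toReal_ofReal (Real.exp_pos _).le,
    ENNReal.toReal_ofReal (by positivity)] at h2
  have h3 : Real.exp (N * (Real.log 2 - θ * ε)) = 2 ^ N / Real.exp (θ * (ε * N)) := by
    have e : (N : ℝ) * (θ * ε) = θ * (ε * N) := by ring
    rw [mul_sub, Real.exp_sub, Real.exp_nat_mul, Real.exp_log (by norm_num), e]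
  rw [h3, le_div_iff₀ (Real.exp_pos _), mul_comm]
  exact h2

/-- Exponential equivalence: if, for every `N` (with `p/N ≤ 1`), the pairs
`(X_N^{(j)}, Y_N^{(j)})`, `j = 1,…,N`, are i.i.d. with `X_N^{(1)} ∼ Binomial(⌊bN⌋, p/N)`,
`Y_N^{(1)} ∼ Poisson(bp)`, and `P(X_N^{(1)} ≠ Y_N^{(1)}) → 0`, then for every `ε > 0` one
has `(1/N)·log P(Σ_j |X_N^{(j)} − Y_N^{(j)}| > εN) → −∞`. -/
theorem exponential_equivalence (b p : ℝ) (hb : 0 < b) (hp : 0 < p)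
    (Ω : ℕ → Type) (mΩ : ∀ N, MeasurableSpace (Ω N))
    (P : ∀ N, MeasureTheory.Measure (Ω N))
    (hP : ∀ N, MeasureTheory.IsProbabilityMeasure (P N))
    (X Y : ∀ N : ℕ, Fin N → Ω N → ℕ)
    (hmX : ∀ N j, Measurable (X N j)) (hmY : ∀ N j, Measurable (Y N j))
    (hiid : ∀ N, ProbabilityTheory.iIndepFun
      (fun j ω => (X N j ω, Y N j ω)) (P N))
    (hident : ∀ N, ∀ j j' : Fin N, ProbabilityTheory.IdentDistrib
      (fun ω => (X N j ω, Y N j ω)) (fun ω => (X N j' ω, Y N j' ω)) (P N) (P N))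
    (hlawX : ∀ N : ℕ, p ≤ N → ∀ j : Fin N,
      (P N).map (X N j) = pmfMeasure (binPMF ⌊b * (N : ℝ)⌋₊ (p / (N : ℝ))))
    (hlawY : ∀ N : ℕ, ∀ j : Fin N, (P N).map (Y N j) = pmfMeasure (poissonPMF (b * p)))
    (hdiff : Filter.Tendsto (fun N : ℕ =>
        ((P (N + 1)) {ω | X (N + 1) 0 ω ≠ Y (N + 1) 0 ω}).toReal)
      Filter.atTop (nhds 0))
    (ε : ℝ) (hε : 0 < ε) :
    Filter.Tendsto (fun N : ℕ =>
        (((N : ℝ)⁻¹ : ℝ) : EReal) * elog (((P N) {ω | ε * (N : ℝ) <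
          ∑ j : Fin N, |((X N j ω : ℝ)) - ((Y N j ω : ℝ))|}).toReal))
      Filter.atTop (nhds (⊥ : EReal)) := by
  rw [EReal.tendsto_nhds_bot_iff_real]
  intro x
  obtain ⟨θ, hθ, hθx⟩ : ∃ θ : ℝ, 0 < θ ∧ Real.log 2 - θ * ε < x := by
    refine ⟨(|Real.log 2 - x| + 1) / ε, by positivity, ?_⟩
    rw [div_mul_cancel₀ _ hε.ne']
    linarith [le_abs_self (Real.log 2 - x)]
  set C := Real.exp (b * p * (Real.exp (4 * θ) - 1)) with hCdef
  have hC : 0 < C := Real.exp_pos _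
  have hz1 : 0 ≤ Real.exp (4 * θ) - 1 := by
    linarith [Real.add_one_le_exp (4 * θ)]
  have hdiff' := hdiff.eventually (gt_mem_nhds (show (0 : ℝ) < 1 / (8 * C) by positivity))
  obtain ⟨n0, hn0⟩ := Filter.eventually_atTop.1 hdiff'
  filter_upwards [Filter.eventually_ge_atTop (n0 + 1), Filter.eventually_ge_atTop ⌈p⌉₊] with N hN hNp
  have hpN : p ≤ N := Nat.ceil_le.1 hNp
  obtain ⟨m, rfl⟩ : ∃ m, N = m + 1 := ⟨N - 1, by omega⟩
  have hNpos : (0 : ℝ) < ((m + 1 : ℕ) : ℝ) := by positivity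
  have := hP (m + 1)
  have hA0 := hn0 m (by omega)
  have key := aux_chernoff (P (m + 1)) (m + 1) (X (m + 1)) (Y (m + 1)) (hmX _) (hmY _)
    (hiid _) θ ε hθ (fun j => by
      refine aux_mom (P (m + 1)) _ _ (hmX _ j) (hmY _ j) θ C hθ hC ?_ ?_ ?_
      · rw [hlawX _ hpN, aux_lint]
        refine (aux_bin _ _ _ (by positivity) ((div_le_one hNpos).2 hpN)
          (Real.exp_pos _).le).trans (ENNReal.ofReal_le_ofReal (Real.exp_le_exp.2 ?_))
        refine mul_le_mul_of_nonneg_right ?_ hz1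
        have := Nat.floor_le (show 0 ≤ b * ((m + 1 : ℕ) : ℝ) by positivity)
        calc _ ≤ (b * ((m + 1 : ℕ) : ℝ)) * (p / ((m + 1 : ℕ) : ℝ)) :=
              mul_le_mul_of_nonneg_right this (by positivity)
          _ = b * p := by field_simp
      · rw [hlawY, aux_lint, aux_poisson _ _ (by positivity) (Real.exp_pos _).le]
      · have he := (hident (m + 1) j 0).measure_mem_eq
          (s := {a : ℕ × ℕ | a.1 ≠ a.2}) (Set.to_countable _).measurableSet
        have he' : P (m + 1) {ω | X (m + 1) j ω ≠ Y (m + 1) j ω} =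
          P (m + 1) {ω | X (m + 1) 0 ω ≠ Y (m + 1) 0 ω} := he
        rw [he', ENNReal.le_ofReal_iff_toReal_le (MeasureTheory.measure_ne_top _ _) (by positivity)]
        exact hA0.le)
  have hinv : (0 : ℝ) < (((m + 1 : ℕ) : ℝ))⁻¹ := inv_pos.2 hNpos
  unfold elog
  split_ifs with h
  · rw [EReal.coe_mul_bot_of_pos hinv]; exact EReal.bot_lt_coe x
  · rw [← EReal.coe_mul, EReal.coe_lt_coe_iff]
    refine lt_of_le_of_lt ?_ hθx
    have hl := Real.log_le_log (not_le.1 h) key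
    rw [Real.log_exp] at hl
    rw [inv_mul_le_iff₀ hNpos]
    exact hl
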